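/- Let B > 0 and A, C be real constants, let r₀ > 0, and suppose r⁴ + C·√(1+Br²) + A > 0 for all r > r₀; set f(r) = √(1 + (C·√(1+Br²) + A)/r⁴) and h(r) = √(1+Br²)·f(r) on (r₀, ∞). If v : (r₀, ∞) → ℝ is twice differentiable and satisfies h(r)²·v''(r) − (h(r)²/r + f'(r)h(r)²/f(r) − h'(r)h(r))·v'(r) = 0 for all r > r₀, then there exist real constants C₁ and C₂ such that v(r) = C₁·√(1+Br²) + C₂ for all r > r₀. -/

import Mathlib

/-- A function with vanishing derivative on `(a, ∞)` is constant there. -/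
theorem exists_const_of_hasDerivAt_zero_Ioi {a : ℝ} {g : ℝ → ℝ}
    (hg : ∀ r : ℝ, a < r → HasDerivAt g 0 r) : ∃ c : ℝ, ∀ r : ℝ, a < r → g r = c := by
  refine ⟨g (a + 1), fun r hr => ?_⟩
  exact isOpen_Ioi.is_const_of_deriv_eq_zero isPreconnected_Ioi
    (fun x hx => (hg x hx).differentiableAt.differentiableWithinAt)
    (fun x hx => (hg x hx).deriv) hr (show a < a + 1 by linarith)

theorem hasDerivAt_sqrt_one_add_mul_sq {B : ℝ} (hB : 0 ≤ B) (r : ℝ) :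
    HasDerivAt (fun x : ℝ => Real.sqrt (1 + B * x ^ 2))
      (B * r / Real.sqrt (1 + B * r ^ 2)) r := by
  have hpos : 0 < 1 + B * r ^ 2 := by positivity
  have hinner : HasDerivAt (fun x : ℝ => 1 + B * x ^ 2) (B * (2 * r)) r := by
    simpa using ((hasDerivAt_pow 2 r).const_mul B).const_add 1
  convert hinner.sqrt hpos.ne' using 1
  field_simp

/-- If `r (1 + B r²) v'' = v'` on `(r₀, ∞)`, then `v` is an affine function of
`√(1 + B r²)` there. -/
theorem exists_eq_mul_sqrt_add_of_reduced_ode {B r₀ : ℝ} (hB : 0 < B) (hr₀ : 0 ≤ r₀)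
    {v : ℝ → ℝ}
    (hv1 : ∀ r : ℝ, r₀ < r → DifferentiableAt ℝ v r)
    (hv2 : ∀ r : ℝ, r₀ < r → DifferentiableAt ℝ (deriv v) r)
    (hode : ∀ r : ℝ, r₀ < r → r * (1 + B * r ^ 2) * deriv (deriv v) r = deriv v r) :
    ∃ C₁ C₂ : ℝ, ∀ r : ℝ, r₀ < r → v r = C₁ * Real.sqrt (1 + B * r ^ 2) + C₂ := by
  have hS (r : ℝ) : 0 < Real.sqrt (1 + B * r ^ 2) := Real.sqrt_pos.2 (by positivity)
  have hS2 (r : ℝ) : Real.sqrt (1 + B * r ^ 2) ^ 2 = 1 + B * r ^ 2 :=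
    Real.sq_sqrt (by positivity)
  obtain ⟨K, hK⟩ : ∃ K : ℝ, ∀ r : ℝ, r₀ < r →
      deriv v r * Real.sqrt (1 + B * r ^ 2) / r = K := by
    apply exists_const_of_hasDerivAt_zero_Ioi
    intro r hr
    have hr0 : r ≠ 0 := (hr₀.trans_lt hr).ne'
    refine (((hv2 r hr).hasDerivAt.mul (hasDerivAt_sqrt_one_add_mul_sq hB.le r)).div
      (hasDerivAt_id r) hr0).congr_deriv ?_
    have hSr := (hS r).ne'
    have h2 := hS2 r
    have ho := hode r hr
    simp only [id, Pi.mul_apply]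
    field_simp
    rw [h2]
    linear_combination ho
  obtain ⟨C₂, hC₂⟩ : ∃ C₂ : ℝ, ∀ r : ℝ, r₀ < r →
      v r - K / B * Real.sqrt (1 + B * r ^ 2) = C₂ := by
    apply exists_const_of_hasDerivAt_zero_Ioi
    intro r hr
    have hr0 : r ≠ 0 := (hr₀.trans_lt hr).ne'
    refine ((hv1 r hr).hasDerivAt.sub
      ((hasDerivAt_sqrt_one_add_mul_sq hB.le r).const_mul (K / B))).congr_deriv ?_
    have hSr := (hS r).ne'
    rw [← hK r hr]
    field_simp
    ring
  exact ⟨K / B, C₂, fun r hr => by linear_combination hC₂ r hr⟩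


/-- the solution of equation (4.16) in the proof of Theorem 4.4.
If h²·v'' − (h²/r + f'h²/f − h'h)·v' = 0 on (r₀,∞), where
f(r) = √(1 + (C√(1+Br²) + A)/r⁴) and h(r) = √(1+Br²)·f(r), then
v = C₁·√(1+Br²) + C₂ for some constants C₁, C₂. -/
theorem eguchi_hanson_typeII_static_ode_solution (B A C : ℝ) (hB : 0 < B)
    (r₀ : ℝ) (hr₀ : 0 < r₀)
    (hpos : ∀ r : ℝ, r₀ < r → 0 < r ^ 4 + C * Real.sqrt (1 + B * r ^ 2) + A)
    (f h : ℝ → ℝ)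
    (hf : ∀ r : ℝ, r₀ < r →
      f r = Real.sqrt (1 + (C * Real.sqrt (1 + B * r ^ 2) + A) / r ^ 4))
    (hh : ∀ r : ℝ, r₀ < r → h r = Real.sqrt (1 + B * r ^ 2) * f r)
    (v : ℝ → ℝ)
    (hv1 : ∀ r : ℝ, r₀ < r → DifferentiableAt ℝ v r)
    (hv2 : ∀ r : ℝ, r₀ < r → DifferentiableAt ℝ (deriv v) r)
    (hode : ∀ r : ℝ, r₀ < r →
      h r ^ 2 * deriv (deriv v) r
        - (h r ^ 2 / r + deriv f r * h r ^ 2 / f r - deriv h r * h r) * deriv v r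
      = 0) :
    ∃ C₁ C₂ : ℝ, ∀ r : ℝ, r₀ < r →
      v r = C₁ * Real.sqrt (1 + B * r ^ 2) + C₂ := by
  refine exists_eq_mul_sqrt_add_of_reduced_ode hB hr₀.le hv1 hv2 fun r hr => ?_
  have hr0 : 0 < r := hr₀.trans hr
  have hnear : ∀ᶠ x in nhds r, r₀ < x := lt_mem_nhds hr
  have hS : 0 < Real.sqrt (1 + B * r ^ 2) := Real.sqrt_pos.2 (by positivity)
  have hS2 : Real.sqrt (1 + B * r ^ 2) ^ 2 = 1 + B * r ^ 2 := Real.sq_sqrt (by positivity)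
  have hSd := hasDerivAt_sqrt_one_add_mul_sq hB.le r
  have hrad : 0 < 1 + (C * Real.sqrt (1 + B * r ^ 2) + A) / r ^ 4 := by
    have hquot := div_pos (hpos r hr) (pow_pos hr0 4)
    rwa [add_assoc, add_div, div_self (pow_ne_zero 4 hr0.ne')] at hquot
  have hf0 : 0 < f r := by
    rw [hf r hr]
    exact Real.sqrt_pos.2 hrad
  have hfd : DifferentiableAt ℝ f r := by
    have hradd : DifferentiableAt ℝ
        (fun x : ℝ => 1 + (C * Real.sqrt (1 + B * x ^ 2) + A) / x ^ 4) r :=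
      (((hSd.differentiableAt.const_mul C).add_const A).div
        (differentiableAt_pow 4) (pow_ne_zero 4 hr0.ne')).const_add 1
    exact (hradd.sqrt hrad.ne').congr_of_eventuallyEq (hnear.mono hf)
  have hhd : deriv h r =
      B * r / Real.sqrt (1 + B * r ^ 2) * f r + Real.sqrt (1 + B * r ^ 2) * deriv f r :=
    ((hSd.mul hfd.hasDerivAt).congr_of_eventuallyEq (hnear.mono hh)).deriv
  have hred := hode r hr
  rw [hhd, hh r hr] at hred
  have hfactor : f r ^ 2 *
      (r * (1 + B * r ^ 2) * deriv (deriv v) r - deriv v r) = 0 := by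
    generalize Real.sqrt (1 + B * r ^ 2) = S at hS hS2 hred
    have hcancel : B * r / S * f r * (S * f r) = B * r * f r ^ 2 := by field_simp
    have hlog : deriv f r * (S * f r) ^ 2 / f r = deriv f r * S ^ 2 * f r := by field_simp
    have hdiv : (S * f r) ^ 2 / r * r = S ^ 2 * f r ^ 2 := by field_simp
    rw [hlog] at hred
    linear_combination r * hred + deriv v r * hdiv - r * deriv v r * hcancel
      - f r ^ 2 * (r * deriv (deriv v) r - deriv v r) * hS2
  exact sub_eq_zero.1 ((mul_eq_zero.1 hfactor).resolve_left (pow_ne_zero 2 hf0.ne'))
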